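/- Suppose the Bessel bound |J_n(t)| ≤ t^{-1/4}(|n|^{1/3} + ||t| - |n||)^{-1/4} holds for t ≥ 1 and n ∈ ℤ, and |J_0(t)| ≤ √(2/(π t)) for t > 0. Then for every γ ∈ [0,1], p > 2+2γ, and n ∈ ℤ with |n| ≥ 1 and 2+2γ < p < 4, we have ∫_1^∞ t^γ |J_n(t)|^p dt ≤ C |n|^{1 + γ - p/2} with C = 8(1/(p-2-2γ) + 1/(4-p)). -/

import Mathlib

open MeasureTheory

noncomputable def besselJ (m : ℤ) (t : ℝ) : ℂ :=
  ((-Complex.I) ^ m / (2 * Real.pi)) *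
    ∫ k in (0:ℝ)..(2 * Real.pi),
      Complex.exp ((m : ℂ) * (k : ℂ) * Complex.I - (t : ℂ) * Complex.cos (k : ℂ) * Complex.I)

noncomputable def besselIntegral (m : ℤ) (t : ℝ) : ℂ :=
  ∫ k in (0:ℝ)..(2 * Real.pi),
    Complex.exp ((m : ℂ) * (k : ℂ) * Complex.I - (t : ℂ) * Complex.cos (k : ℂ) * Complex.I)

theorem norm_besselJ (m : ℤ) (t : ℝ) :
    ‖besselJ m t‖ = (2 * Real.pi)⁻¹ * ‖besselIntegral m t‖ := by
  have : |Real.pi| = Real.pi := abs_of_pos Real.pi_pos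
  simp [besselJ, besselIntegral, this]

/-- The integral form of the three-term recurrence for Bessel functions. -/
theorem besselIntegral_recurrence (m : ℤ) (t : ℝ) :
    2 * Complex.I * (m : ℂ) * besselIntegral m t =
      (t : ℂ) * (besselIntegral (m - 1) t - besselIntegral (m + 1) t) := by
  have hderiv : ∀ k : ℝ, HasDerivAt
      (fun k : ℝ => Complex.exp ((m : ℂ) * (k : ℂ) * Complex.I
        - (t : ℂ) * Complex.cos (k : ℂ) * Complex.I))
      (Complex.exp ((m : ℂ) * (k : ℂ) * Complex.I - (t : ℂ) * Complex.cos (k : ℂ) * Complex.I) *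
        ((m : ℂ) * Complex.I + (t : ℂ) * Complex.sin (k : ℂ) * Complex.I)) k := by
    intro k
    have h : HasDerivAt (fun z : ℂ => Complex.exp ((m : ℂ) * z * Complex.I
        - (t : ℂ) * Complex.cos z * Complex.I))
      (Complex.exp ((m : ℂ) * (k : ℂ) * Complex.I - (t : ℂ) * Complex.cos (k : ℂ) * Complex.I) *
        ((m : ℂ) * Complex.I + (t : ℂ) * Complex.sin (k : ℂ) * Complex.I)) (k : ℂ) := by
      have h := (((((hasDerivAt_id (k : ℂ)).const_mul (m : ℂ)).mul_const Complex.I).sub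
        (((Complex.hasDerivAt_cos (k : ℂ)).const_mul (t : ℂ)).mul_const Complex.I)).cexp)
      refine (h.congr_deriv ?_)
      simp [Pi.sub_apply]
    exact h.comp_ofReal
  have hftc := intervalIntegral.integral_eq_sub_of_hasDerivAt (a := 0) (b := 2 * Real.pi)
    (fun k _ => hderiv k) (Continuous.intervalIntegrable (by fun_prop) _ _)
  have hperiod : Complex.exp ((m : ℂ) * ((2 * Real.pi : ℝ) : ℂ) * Complex.I
        - (t : ℂ) * Complex.cos ((2 * Real.pi : ℝ) : ℂ) * Complex.I)
      = Complex.exp ((m : ℂ) * ((0 : ℝ) : ℂ) * Complex.I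
        - (t : ℂ) * Complex.cos ((0 : ℝ) : ℂ) * Complex.I) := by
    rw [Complex.exp_eq_exp_iff_exists_int]
    refine ⟨m, ?_⟩
    push_cast
    rw [Complex.cos_two_pi, Complex.cos_zero]
    ring
  rw [hperiod, sub_self] at hftc
  have hint : ∀ j : ℤ, IntervalIntegrable (fun k : ℝ => Complex.exp ((j : ℂ) * (k : ℂ) * Complex.I
        - (t : ℂ) * Complex.cos (k : ℂ) * Complex.I)) volume 0 (2 * Real.pi) := fun j =>
    Continuous.intervalIntegrable (by fun_prop) _ _
  have hpt : ∀ k : ℝ,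
      2 * (Complex.exp ((m : ℂ) * (k : ℂ) * Complex.I
        - (t : ℂ) * Complex.cos (k : ℂ) * Complex.I) *
        ((m : ℂ) * Complex.I + (t : ℂ) * Complex.sin (k : ℂ) * Complex.I)) =
      2 * Complex.I * (m : ℂ) * Complex.exp ((m : ℂ) * (k : ℂ) * Complex.I
        - (t : ℂ) * Complex.cos (k : ℂ) * Complex.I) -
      (t : ℂ) * (Complex.exp (((m - 1 : ℤ) : ℂ) * (k : ℂ) * Complex.I
        - (t : ℂ) * Complex.cos (k : ℂ) * Complex.I) -
        Complex.exp (((m + 1 : ℤ) : ℂ) * (k : ℂ) * Complex.I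
        - (t : ℂ) * Complex.cos (k : ℂ) * Complex.I)) := by
    intro k
    have e1 : Complex.exp (((m - 1 : ℤ) : ℂ) * (k : ℂ) * Complex.I
        - (t : ℂ) * Complex.cos (k : ℂ) * Complex.I) =
        Complex.exp ((m : ℂ) * (k : ℂ) * Complex.I - (t : ℂ) * Complex.cos (k : ℂ) * Complex.I) *
          Complex.exp (-(k : ℂ) * Complex.I) := by
      rw [← Complex.exp_add]; congr 1; push_cast; ring
    have e2 : Complex.exp (((m + 1 : ℤ) : ℂ) * (k : ℂ) * Complex.I
        - (t : ℂ) * Complex.cos (k : ℂ) * Complex.I) =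
        Complex.exp ((m : ℂ) * (k : ℂ) * Complex.I - (t : ℂ) * Complex.cos (k : ℂ) * Complex.I) *
          Complex.exp ((k : ℂ) * Complex.I) := by
      rw [← Complex.exp_add]; congr 1; push_cast; ring
    rw [e1, e2, Complex.sin]
    linear_combination (Complex.exp ((m : ℂ) * (k : ℂ) * Complex.I
      - (t : ℂ) * Complex.cos (k : ℂ) * Complex.I)) * (t : ℂ) *
      (Complex.exp (-(k : ℂ) * Complex.I) - Complex.exp ((k : ℂ) * Complex.I)) * Complex.I_mul_I
  have hzero := congrArg (fun z : ℂ => 2 * z) hftc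
  simp only [mul_zero] at hzero
  rw [← intervalIntegral.integral_const_mul] at hzero
  simp_rw [hpt] at hzero
  rw [intervalIntegral.integral_sub ((hint m).const_mul _)
      (((hint (m - 1)).sub (hint (m + 1))).const_mul _),
    intervalIntegral.integral_const_mul, intervalIntegral.integral_const_mul,
    intervalIntegral.integral_sub (hint (m - 1)) (hint (m + 1)), sub_eq_zero] at hzero
  exact hzero

theorem abs_mul_norm_besselJ_le (m : ℤ) {t : ℝ} (ht : 0 ≤ t) :
    |(m : ℝ)| * ‖besselJ m t‖ ≤ t / 2 * (‖besselJ (m - 1) t‖ + ‖besselJ (m + 1) t‖) := by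
  have h := congrArg norm (besselIntegral_recurrence m t)
  simp only [norm_mul, Complex.norm_I, Complex.norm_intCast, Complex.norm_real,
    Complex.norm_ofNat, Real.norm_eq_abs, abs_of_nonneg ht, mul_one] at h
  have htri := mul_le_mul_of_nonneg_left
    (norm_sub_le (besselIntegral (m - 1) t) (besselIntegral (m + 1) t)) ht
  rw [← h] at htri
  have hpi : (0 : ℝ) ≤ (2 * Real.pi)⁻¹ := by positivity
  have := mul_le_mul_of_nonneg_left htri hpi
  simp only [norm_besselJ]
  nlinarith

theorem rpow_le_of_le_fused {x c t u p : ℝ} (hx : 0 ≤ x) (hc : 0 ≤ c) (ht : 0 ≤ t) (hu : 0 ≤ u)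
    (hp : 0 ≤ p) (h : x ≤ c * (t ^ (-(1/4 : ℝ)) * u ^ (-(1/4 : ℝ)))) :
    x ^ p ≤ c ^ p * (t ^ (-(p / 4)) * u ^ (-(p / 4))) := by
  refine (Real.rpow_le_rpow hx h hp).trans_eq ?_
  rw [Real.mul_rpow hc (by positivity), Real.mul_rpow (by positivity) (by positivity),
    ← Real.rpow_mul ht, ← Real.rpow_mul hu]
  ring_nf

theorem norm_besselJ_le_of_ne {n : ℤ} {t : ℝ} (ht : 1 ≤ t) (hne : t ≠ |(n : ℝ)|)
    (hfused : ‖besselJ n t‖ ≤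
      t ^ (-(1/4 : ℝ)) * (|(n : ℝ)| ^ (1/3 : ℝ) + |(|t| - |(n : ℝ)|)|) ^ (-(1/4 : ℝ))) :
    ‖besselJ n t‖ ≤ t ^ (-(1/4 : ℝ)) * |(t - |(n : ℝ)|)| ^ (-(1/4 : ℝ)) := by
  refine hfused.trans ?_
  rw [abs_of_nonneg (zero_le_one.trans ht)]
  gcongr ?_ * ?_
  refine Real.rpow_le_rpow_of_nonpos (abs_pos.2 (sub_ne_zero.2 hne)) ?_ (by norm_num)
  have : (0 : ℝ) ≤ |(n : ℝ)| ^ (1/3 : ℝ) := by positivity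
  linarith

/-- Below the transition point the recurrence gains a factor `t / |n|` over the fused bound. -/
theorem norm_besselJ_le_of_lt {n : ℤ} {t : ℝ} (ht : 1 ≤ t) (htn : t < |(n : ℝ)|)
    (hfused : ∀ m : ℤ, ‖besselJ m t‖ ≤
      t ^ (-(1/4 : ℝ)) * (|(m : ℝ)| ^ (1/3 : ℝ) + |(|t| - |(m : ℝ)|)|) ^ (-(1/4 : ℝ))) :
    ‖besselJ n t‖ ≤ t / |(n : ℝ)| *
      (t ^ (-(1/4 : ℝ)) * (|(n : ℝ)| - t) ^ (-(1/4 : ℝ))) := by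
  have ht0 : 0 ≤ t := zero_le_one.trans ht
  have hn2 : 2 ≤ |n| := by
    have : (1 : ℝ) < ((|n| : ℤ) : ℝ) := by push_cast; linarith
    have : 1 < |n| := by exact_mod_cast this
    omega
  have key : ∀ m : ℤ, 1 ≤ |m| → |n| ≤ |m| + 1 →
      ‖besselJ m t‖ ≤ t ^ (-(1/4 : ℝ)) * (|(n : ℝ)| - t) ^ (-(1/4 : ℝ)) := by
    intro m hm hnm
    refine (hfused m).trans ?_
    gcongr ?_ * ?_
    refine Real.rpow_le_rpow_of_nonpos (sub_pos.2 htn) ?_ (by norm_num)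
    have hm' : (1 : ℝ) ≤ |(m : ℝ)| := by exact_mod_cast hm
    have hnm' : |(n : ℝ)| ≤ |(m : ℝ)| + 1 := by exact_mod_cast hnm
    have h1 : (1 : ℝ) ≤ |(m : ℝ)| ^ (1/3 : ℝ) := Real.one_le_rpow hm' (by norm_num)
    rw [abs_of_nonneg ht0]
    linarith [neg_abs_le (t - |(m : ℝ)|)]
  have h1 := key (n - 1) (by grind) (by grind)
  have h2 := key (n + 1) (by grind) (by grind)
  have hrec := abs_mul_norm_besselJ_le n ht0
  have hn0 : 0 < |(n : ℝ)| := by linarith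
  rw [div_mul_eq_mul_div, le_div_iff₀ hn0]
  nlinarith

theorem integrableOn_sub_rpow {a N : ℝ} (ha : a < 1) (hN : 0 ≤ N) :
    IntegrableOn (fun t => (N - t) ^ (-a)) (Set.Ioc 0 N) ∧
      ∫ t in Set.Ioc 0 N, (N - t) ^ (-a) = N ^ (1 - a) / (1 - a) := by
  constructor
  · have h := (intervalIntegral.intervalIntegrable_rpow' (a := 0) (b := N)
      (r := -a) (by linarith)).comp_sub_left N
    rw [sub_zero, sub_self] at h
    exact (intervalIntegrable_iff_integrableOn_Ioc_of_le hN).1 h.symm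
  · rw [← intervalIntegral.integral_of_le hN,
      intervalIntegral.integral_comp_sub_left (fun x => x ^ (-a)), sub_self, sub_zero,
      integral_rpow (Or.inl (by linarith)), Real.zero_rpow (by linarith)]
    ring_nf

theorem integrableOn_rpow_sub {a N : ℝ} (ha : a < 1) (hN : 0 ≤ N) :
    IntegrableOn (fun t => (t - N) ^ (-a)) (Set.Ioc N (2 * N)) ∧
      ∫ t in Set.Ioc N (2 * N), (t - N) ^ (-a) = N ^ (1 - a) / (1 - a) := by
  have hN2 : N ≤ 2 * N := by linarith
  constructor
  · have h := (intervalIntegral.intervalIntegrable_rpow' (a := 0) (b := N)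
      (r := -a) (by linarith)).comp_sub_right N
    rw [zero_add, ← two_mul] at h
    exact (intervalIntegrable_iff_integrableOn_Ioc_of_le hN2).1 h
  · rw [← intervalIntegral.integral_of_le hN2,
      intervalIntegral.integral_comp_sub_right (fun x => x ^ (-a)), sub_self, two_mul,
      add_sub_cancel_right,
      integral_rpow (Or.inl (by linarith)), Real.zero_rpow (by linarith)]
    ring_nf

theorem stmt_14
    (hfused : ∀ (n : ℤ) (t : ℝ), 1 ≤ t →
      ‖besselJ n t‖ ≤ t ^ (-(1/4 : ℝ)) * (|(n : ℝ)| ^ (1/3 : ℝ) + |(|t| - |(n : ℝ)|)|) ^ (-(1/4 : ℝ)))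
    (hzero : ∀ t : ℝ, 0 < t → ‖besselJ 0 t‖ ≤ Real.sqrt (2 / (Real.pi * t)))
    (γ p : ℝ) (hγ0 : 0 ≤ γ) (hγ1 : γ ≤ 1) (hp1 : 2 + 2 * γ < p) (hp2 : p < 4)
    (n : ℤ) (hn : 1 ≤ |n|) :
    (∫ t in Set.Ioi (1:ℝ), t ^ γ * ‖besselJ n t‖ ^ p) ≤
      8 * (1 / (p - 2 - 2 * γ) + 1 / (4 - p)) * |(n : ℝ)| ^ (1 + γ - p / 2) := by
  have hp0 : 0 ≤ p := by linarith
  have hN1 : (1 : ℝ) ≤ |(n : ℝ)| := by exact_mod_cast hn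
  set N : ℝ := |(n : ℝ)| with hN
  have hN0 : 0 < N := by linarith
  obtain ⟨i1, v1⟩ := integrableOn_sub_rpow (a := p / 4) (by linarith) hN0.le
  obtain ⟨i2, v2⟩ := integrableOn_rpow_sub (a := p / 4) (by linarith) hN0.le
  have i3 : IntegrableOn (fun t : ℝ => t ^ (γ - p / 2)) (Set.Ioi (2 * N)) :=
    integrableOn_Ioi_rpow_of_lt (by linarith) (by positivity)
  have v3 : ∫ t in Set.Ioi (2 * N), t ^ (γ - p / 2) =
      -(2 * N) ^ (γ - p / 2 + 1) / (γ - p / 2 + 1) :=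
    integral_Ioi_rpow_of_lt (by linarith) (by positivity)
  let g1 := (Set.Ioc 0 N).indicator (fun t => N ^ (γ - p / 4) * (N - t) ^ (-(p / 4)))
  let g2 := (Set.Ioc N (2 * N)).indicator (fun t => N ^ (γ - p / 4) * (t - N) ^ (-(p / 4)))
  let g3 := (Set.Ioi (2 * N)).indicator (fun t => 2 * t ^ (γ - p / 2))
  have j1 : Integrable g1 := IntegrableOn.integrable_indicator (i1.const_mul _) measurableSet_Ioc
  have j2 : Integrable g2 := IntegrableOn.integrable_indicator (i2.const_mul _) measurableSet_Ioc
  have j3 : Integrable g3 := IntegrableOn.integrable_indicator (i3.const_mul _) measurableSet_Ioi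
  have hbound : (∫ t in Set.Ioi (1:ℝ), t ^ γ * ‖besselJ n t‖ ^ p) ≤
      ∫ t, (g1 t + g2 t + g3 t) := by
    rw [← integral_indicator measurableSet_Ioi]
    refine integral_mono_of_nonneg (Filter.Eventually.of_forall fun t => ?_)
      ((j1.add j2).add j3) ?_
    · refine Set.indicator_nonneg (fun t ht => ?_) t
      have : (0 : ℝ) < t := zero_lt_one.trans ht
      positivity
    filter_upwards [Measure.ae_ne volume N] with t htN
    by_cases ht : t ∈ Set.Ioi (1 : ℝ)
    swap
    · rw [Set.indicator_of_notMem ht]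
      refine add_nonneg (add_nonneg ?_ ?_) ?_
      · refine Set.indicator_nonneg (fun s hs => ?_) t
        have := sub_nonneg.2 hs.2
        positivity
      · refine Set.indicator_nonneg (fun s hs => ?_) t
        have := sub_nonneg.2 hs.1.le
        positivity
      · refine Set.indicator_nonneg (fun s hs => ?_) t
        have : 0 < s := lt_trans (by positivity) hs
        positivity
    rw [Set.indicator_of_mem ht]
    have ht1 : 1 ≤ t := le_of_lt ht
    have ht0 : 0 < t := by linarith
    rcases lt_or_gt_of_ne htN with hlt | hgt
    · have e1 : g1 t = N ^ (γ - p / 4) * (N - t) ^ (-(p / 4)) :=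
        Set.indicator_of_mem (Set.mem_Ioc.2 ⟨ht0, hlt.le⟩) _
      have e2 : g2 t = 0 := Set.indicator_of_notMem (fun h => by linarith [h.1]) _
      have e3 : g3 t = 0 :=
        Set.indicator_of_notMem (fun h => by linarith [Set.mem_Ioi.1 h]) _
      rw [e1, e2, e3, add_zero, add_zero]
      have hu : 0 ≤ N - t := by linarith
      have h := rpow_le_of_le_fused (norm_nonneg _) (by positivity) ht0.le hu hp0
        (norm_besselJ_le_of_lt ht1 hlt (fun m => hfused m t ht1))
      calc t ^ γ * ‖besselJ n t‖ ^ p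
          ≤ t ^ γ * ((t / N) ^ p * (t ^ (-(p / 4)) * (N - t) ^ (-(p / 4)))) := by gcongr
        _ = N ^ (γ - p / 4) * (t / N) ^ (p + (γ - p / 4)) * (N - t) ^ (-(p / 4)) := by
          rw [Real.rpow_add (by positivity), Real.div_rpow ht0.le hN0.le (γ - p / 4),
            sub_eq_add_neg γ, Real.rpow_add ht0]
          field_simp
        _ ≤ N ^ (γ - p / 4) * 1 * (N - t) ^ (-(p / 4)) := by
          gcongr
          exact Real.rpow_le_one (by positivity) ((div_le_one hN0).2 hlt.le) (by linarith)
        _ = _ := by rw [mul_one]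
    · have e1 : g1 t = 0 := Set.indicator_of_notMem (fun h => by linarith [h.2]) _
      have hu : 0 < t - N := by linarith
      have hJ := norm_besselJ_le_of_ne ht1 htN (hfused n t ht1)
      rw [← hN, abs_of_pos hu, ← one_mul (t ^ _ * _)] at hJ
      have h := rpow_le_of_le_fused (norm_nonneg _) zero_le_one ht0.le hu.le hp0 hJ
      rw [Real.one_rpow, one_mul] at h
      have hmain : t ^ γ * ‖besselJ n t‖ ^ p ≤ t ^ (γ - p / 4) * (t - N) ^ (-(p / 4)) := by
        rw [sub_eq_add_neg γ, Real.rpow_add ht0, mul_assoc]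
        gcongr
      rcases le_or_gt t (2 * N) with h2 | h2
      · have e2 : g2 t = N ^ (γ - p / 4) * (t - N) ^ (-(p / 4)) :=
          Set.indicator_of_mem (Set.mem_Ioc.2 ⟨hgt, h2⟩) _
        have e3 : g3 t = 0 :=
          Set.indicator_of_notMem (fun h => by linarith [Set.mem_Ioi.1 h]) _
        rw [e1, e2, e3, add_zero, zero_add]
        refine hmain.trans ?_
        gcongr ?_ * _
        exact Real.rpow_le_rpow_of_nonpos hN0 hgt.le (by linarith)
      · have e2 : g2 t = 0 := Set.indicator_of_notMem (fun h => by linarith [h.2]) _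
        have e3 : g3 t = 2 * t ^ (γ - p / 2) := Set.indicator_of_mem (Set.mem_Ioi.2 h2) _
        rw [e1, e2, e3, add_zero, zero_add]
        have hhalf : (t - N) ^ (-(p / 4)) ≤ 2 * t ^ (-(p / 4)) := by
          calc (t - N) ^ (-(p / 4)) ≤ (t / 2) ^ (-(p / 4)) :=
                Real.rpow_le_rpow_of_nonpos (by positivity) (by linarith) (by linarith)
            _ = 2 ^ (p / 4) * t ^ (-(p / 4)) := by
                rw [Real.div_rpow ht0.le (by norm_num), Real.rpow_neg (by norm_num : (0:ℝ) ≤ 2)]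
                field_simp
            _ ≤ 2 ^ (1 : ℝ) * t ^ (-(p / 4)) := by
                gcongr
                · norm_num
                · linarith
            _ = _ := by rw [Real.rpow_one]
        calc t ^ γ * ‖besselJ n t‖ ^ p ≤ t ^ (γ - p / 4) * (t - N) ^ (-(p / 4)) := hmain
          _ ≤ t ^ (γ - p / 4) * (2 * t ^ (-(p / 4))) := by gcongr
          _ = 2 * t ^ (γ - p / 2) := by
            rw [mul_left_comm, ← Real.rpow_add ht0]
            ring_nf
  refine hbound.trans ?_
  have hsum : ∫ t, (g1 t + g2 t + g3 t) = (∫ t, g1 t) + (∫ t, g2 t) + ∫ t, g3 t :=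
    (integral_add (j1.add j2) j3).trans (congrArg (· + _) (integral_add j1 j2))
  rw [hsum, integral_indicator measurableSet_Ioc,
    integral_indicator measurableSet_Ioc, integral_indicator measurableSet_Ioi,
    integral_const_mul, integral_const_mul, integral_const_mul, v1, v2, v3]
  have hmul : N ^ (γ - p / 4) * N ^ (1 - p / 4) = N ^ (1 + γ - p / 2) := by
    rw [← Real.rpow_add hN0]
    ring_nf
  have htail : (2 * N) ^ (γ - p / 2 + 1) ≤ N ^ (1 + γ - p / 2) := by
    rw [show γ - p / 2 + 1 = 1 + γ - p / 2 by ring]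
    exact Real.rpow_le_rpow_of_nonpos hN0 (by linarith) (by linarith)
  have hpow : 0 ≤ N ^ (1 + γ - p / 2) := by positivity
  have hδ : 0 < p - 2 - 2 * γ := by linarith
  have hε : 0 < 4 - p := by linarith
  calc _ = 8 / (4 - p) * (N ^ (γ - p / 4) * N ^ (1 - p / 4)) +
        4 / (p - 2 - 2 * γ) * (2 * N) ^ (γ - p / 2 + 1) := by
        rw [show 1 - p / 4 = (4 - p) / 4 by ring]
        rw [neg_div, ← div_neg, show -(γ - p / 2 + 1) = (p - 2 - 2 * γ) / 2 by ring]
        field_simp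
        ring
    _ ≤ 8 / (4 - p) * N ^ (1 + γ - p / 2) + 8 / (p - 2 - 2 * γ) * N ^ (1 + γ - p / 2) := by
        rw [hmul]
        gcongr
        norm_num
    _ = _ := by ring
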